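/- Let d ≥ 1, n ≥ d+1, and let H be a family of (d+1)-element subsets of {1,…,n}. Define the complex measurement map α_H : (Fin n → Fin d → ℂ) → (H → ℂ) sending a complex configuration p to the tuple (vol_σ(p))_{σ ∈ H}, where vol_σ(p) is the determinant of the (d+1)×(d+1) complex matrix whose columns have first entry 1 followed by the coordinates of the points of p indexed by σ in increasing order. Then the following are equivalent: (i) there exists a real configuration p : Fin n → (Fin d → ℝ) at which the gradients ∇vol_σ(p), σ ∈ H, are linearly independent (i.e. H is independent in the d-volume rigidity matroid R_n^d); (ii) the image of α_H is Zariski dense in ℂ^H, i.e. the only polynomial in the variables (y_σ)_{σ ∈ H} with complex coefficients vanishing identically on the image of α_H is the zero polynomial. (This expresses that R_n^d is the algebraic matroid of the complex measurement variety CM_n^d.) -/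

import Mathlib

/-- The signed `d`-volume, over the field `K`, of the `(d+1)`-element simplex `σ ⊆ Fin n`
at the configuration `p : Fin n → Fin d → K`.  Junk value `0` if `σ` does not have `d+1`
elements. -/
noncomputable def vol (K : Type) [Field K] {n : ℕ} (d : ℕ) (σ : Finset (Fin n))
    (p : Fin n → Fin d → K) : K :=
  if h : σ.card = d + 1 then
    Matrix.det
      ((Matrix.of (Fin.cons (fun _ => (1 : K)) fun i j => p (σ.orderEmbOfFin h j) i) :
        Matrix (Fin (d + 1)) (Fin (d + 1)) K))
  else 0

open MvPolynomial
open scoped Matrix TensorProduct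

lemma exists_deriv {k A K : Type} [Field k] [CharZero k] [CommRing A] [IsDomain A] [Algebra k A]
    [Field K] [Algebra k K] [Algebra A K] [IsScalarTower k A K] [FaithfulSMul A K]
    [Algebra.EssFiniteType k K] (D : Derivation k A K) :
    ∃ D' : Derivation k K K, ∀ a, D' (algebraMap A K a) = D a := by
  let _ := FractionRing.liftAlgebra A K
  have : IsScalarTower A (FractionRing A) K := inferInstance
  have : IsScalarTower k (FractionRing A) K := inferInstance
  have : CharZero (FractionRing A) := charZero_of_injective_algebraMap (algebraMap k _).injective
  have : Algebra.EssFiniteType (FractionRing A) K := .of_comp k _ _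
  have : Algebra.FormallySmooth (FractionRing A) K := inferInstance
  have : Algebra.FormallySmooth A (FractionRing A) := .of_isLocalization (nonZeroDivisors _)
  have : Algebra.FormallySmooth A K := .comp _ (FractionRing A) _
  have hinj : Function.Injective (KaehlerDifferential.mapBaseChange k A K) := by
    rw [injective_iff_map_eq_zero]
    intro x hx
    obtain ⟨y, rfl⟩ := (Algebra.H1Cotangent.exact_δ_mapBaseChange k A K x).1 hx
    rw [Subsingleton.elim y 0, map_zero]
  obtain ⟨r, hr⟩ := (KaehlerDifferential.mapBaseChange k A K).exists_leftInverse_of_injective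
    (LinearMap.ker_eq_bot.2 hinj)
  refine ⟨((((LinearMap.liftBaseChange K D.liftKaehlerDifferential)).comp r).compDer
    (KaehlerDifferential.D k K)), fun a => ?_⟩
  have h := LinearMap.congr_fun hr (1 ⊗ₜ KaehlerDifferential.D k A a)
  simp at h
  simp [h]


lemma derivation_sum {k ι K : Type} [Fintype ι] [Field k] [CommRing K] [Algebra k K]
    [Algebra (MvPolynomial ι k) K] [IsScalarTower k (MvPolynomial ι k) K]
    (D : Derivation k (MvPolynomial ι k) K) (f : MvPolynomial ι k) :
    D f = ∑ j, algebraMap _ K (pderiv j f) * D (X j) := by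
  classical
  induction f using MvPolynomial.induction_on with
  | C a => simp
  | add p q hp hq => simp [hp, hq, add_mul, Finset.sum_add_distrib]
  | mul_X p i hp =>
    rw [Derivation.leibniz, hp]
    simp only [pderiv_mul, map_add, map_mul, add_mul, Finset.sum_add_distrib, pderiv_X,
      Algebra.smul_def, Finset.mul_sum, Pi.single_apply]
    rw [add_comm]
    congr 1
    · exact Finset.sum_congr rfl fun _ _ => by ring
    · simp [apply_ite]

/-- The chain rule for polynomials. -/
lemma pderiv_aeval_chain {k ι κ : Type} [Fintype κ] [Field k]
    (F : κ → MvPolynomial ι k) (g : MvPolynomial κ k) (j : ι) :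
    pderiv j (aeval F g) = ∑ s, aeval F (pderiv s g) * pderiv j (F s) := by
  classical
  induction g using MvPolynomial.induction_on with
  | C a => simp [algebraMap_eq]
  | add p q hp hq => simp only [map_add, hp, hq, add_mul, Finset.sum_add_distrib]
  | mul_X p i hp =>
    simp only [map_mul, aeval_X, pderiv_mul, hp, map_add, add_mul, Finset.sum_add_distrib,
      Finset.sum_mul, pderiv_X, Pi.single_apply]
    congr 1
    · exact Finset.sum_congr rfl fun _ _ => by ring
    · simp [apply_ite]

lemma hasFDerivAt_eval {ι E : Type} [Fintype ι] [NormedAddCommGroup E] [NormedSpace ℝ E]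
    (c : ι → (E →L[ℝ] ℝ)) (f : MvPolynomial ι ℝ) (p : E) :
    HasFDerivAt (fun q : E => eval (fun j => c j q) f)
      (∑ j, eval (fun j => c j p) (pderiv j f) • c j) p := by
  classical
  induction f using MvPolynomial.induction_on with
  | C a => simpa using hasFDerivAt_const a p
  | add f q hp hq =>
    simp only [map_add, add_smul, Finset.sum_add_distrib]
    exact hp.add hq
  | mul_X f i hp =>
    have := hp.mul (c i).hasFDerivAt (x := p)
    have he : (fun q : E => eval (fun j => c j q) (f * X i)) =
        (fun q : E => eval (fun j => c j q) f) * (c i) := by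
      funext q
      simp
    rw [he]
    refine this.congr_fderiv ?_
    simp only [pderiv_mul, map_add, map_mul, eval_X, add_smul, Finset.sum_add_distrib, pderiv_X,
      Pi.single_apply, Finset.smul_sum, smul_smul]
    rw [add_comm]
    congr 1
    · exact Finset.sum_congr rfl fun _ _ => by rw [mul_comm]
    · simp [apply_ite]

lemma exists_right_inv_aux {ι κ K : Type} [Fintype ι] [Fintype κ] [DecidableEq κ]
    (F : κ → MvPolynomial ι ℝ)
    (hF : Function.Injective (aeval F : MvPolynomial κ ℝ →ₐ[ℝ] MvPolynomial ι ℝ))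
    [Field K] [Algebra (MvPolynomial ι ℝ) K] [IsFractionRing (MvPolynomial ι ℝ) K]
    [Algebra ℝ K] [IsScalarTower ℝ (MvPolynomial ι ℝ) K] :
    ∃ (q : MvPolynomial ι ℝ) (B : ι → κ → MvPolynomial ι ℝ), q ≠ 0 ∧ ∀ s t,
      ∑ j, pderiv j (F s) * B j t = if s = t then q else 0 := by
  let _ : Algebra (MvPolynomial κ ℝ) K :=
    ((algebraMap (MvPolynomial ι ℝ) K).comp
      (aeval F : MvPolynomial κ ℝ →ₐ[ℝ] MvPolynomial ι ℝ).toRingHom).toAlgebra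
  have halg : ∀ a, algebraMap (MvPolynomial κ ℝ) K a =
    algebraMap (MvPolynomial ι ℝ) K (aeval F a) := fun a => rfl
  have : IsScalarTower ℝ (MvPolynomial κ ℝ) K := .of_algebraMap_eq fun x => by
    rw [halg, AlgHom.commutes, ← IsScalarTower.algebraMap_apply]
  have : FaithfulSMul (MvPolynomial κ ℝ) K := (faithfulSMul_iff_algebraMap_injective _ _).2
    ((IsFractionRing.injective (MvPolynomial ι ℝ) K).comp hF)
  have : Algebra.EssFiniteType (MvPolynomial ι ℝ) K :=
    .of_isLocalization _ (nonZeroDivisors (MvPolynomial ι ℝ))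
  have : Algebra.EssFiniteType ℝ K := .comp _ (MvPolynomial ι ℝ) _
  have key : ∀ t : κ, ∃ b : ι → K, ∀ s,
      ∑ j, algebraMap (MvPolynomial ι ℝ) K (pderiv j (F s)) * b j = if s = t then 1 else 0 := by
    intro t
    obtain ⟨D, hD⟩ := exists_deriv (k := ℝ) (K := K)
      ((Algebra.linearMap (MvPolynomial κ ℝ) K).compDer (pderiv t))
    refine ⟨fun j => D (algebraMap (MvPolynomial ι ℝ) K (X j)), fun s => ?_⟩
    have h1 := derivation_sum (D.compAlgebraMap (MvPolynomial ι ℝ)) (F s)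
    have h2 := hD (X s)
    rw [halg, aeval_X] at h2
    refine h1.symm.trans (h2.trans ?_)
    simp [Pi.single_apply, apply_ite]
  choose b hb using key
  obtain ⟨⟨q, hq⟩, hB⟩ := IsLocalization.exist_integer_multiples_of_finite
    (nonZeroDivisors (MvPolynomial ι ℝ)) (fun x : κ × ι => b x.1 x.2)
  choose B hB using hB
  refine ⟨q, fun j t => B (t, j), nonZeroDivisors.ne_zero hq, fun s t => ?_⟩
  apply IsFractionRing.injective (MvPolynomial ι ℝ) K
  have h3 := congrArg (fun z => algebraMap (MvPolynomial ι ℝ) K q * z) (hb t s)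
  simp only [Finset.mul_sum] at h3
  rw [map_sum]
  refine Eq.trans (Finset.sum_congr rfl fun j _ => ?_) (h3.trans ?_)
  · rw [map_mul, hB, Algebra.smul_def]; ring
  · split_ifs <;> simp

lemma exists_right_inv {ι κ : Type} [Fintype ι] [Fintype κ] [DecidableEq κ]
    (F : κ → MvPolynomial ι ℝ)
    (hF : Function.Injective (aeval F : MvPolynomial κ ℝ →ₐ[ℝ] MvPolynomial ι ℝ)) :
    ∃ (q : MvPolynomial ι ℝ) (B : ι → κ → MvPolynomial ι ℝ), q ≠ 0 ∧ ∀ s t,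
      ∑ j, pderiv j (F s) * B j t = if s = t then q else 0 :=
  exists_right_inv_aux (K := FractionRing (MvPolynomial ι ℝ)) F hF

/-- Algebraic independence of the `F s` from a Jacobian with trivial left kernel. -/
lemma eq_zero_of_jacobian {ι κ : Type} [Fintype ι] [Fintype κ] (F : κ → MvPolynomial ι ℂ)
    (hJ : ∀ v : κ → MvPolynomial ι ℂ, (∀ j, ∑ s, v s * pderiv j (F s) = 0) → v = 0)
    (N : ℕ) : ∀ g : MvPolynomial κ ℂ, g.totalDegree ≤ N → aeval F g = 0 → g = 0 := by
  induction N with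
  | zero =>
    intro g hg h
    rw [totalDegree_eq_zero_iff_eq_C.1 (Nat.le_zero.1 hg)] at h ⊢
    simpa [algebraMap_eq] using h
  | succ N ih =>
    intro g hg h
    have hz : ∀ s, pderiv s g = 0 := by
      intro s
      apply ih
      · rw [totalDegree, Finset.sup_le_iff]
        intro m hm
        rw [mem_support_iff, coeff_pderiv] at hm
        have h1 := le_totalDegree (mem_support_iff.2 (left_ne_zero_of_mul hm))
        rw [Finsupp.sum_add_index' (by simp) (by simp)] at h1
        simp at h1
        simp only [Finsupp.sum] at *
        omega
      · exact congrFun (hJ (fun s => aeval F (pderiv s g)) fun j => by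
          rw [← pderiv_aeval_chain, h, map_zero]) s
    have hc : g.totalDegree = 0 := by
      rw [← Nat.le_zero, totalDegree, Finset.sup_le_iff]
      intro m hm
      by_contra hne
      have : m ≠ 0 := by rintro rfl; simp at hne
      obtain ⟨s, hs⟩ := Finsupp.ne_iff.1 this
      have h1 := congrArg (coeff (m - Finsupp.single s 1)) (hz s)
      rw [coeff_pderiv, tsub_add_cancel_of_le (by
        simpa using Nat.one_le_iff_ne_zero.2 hs)] at h1
      rw [mem_support_iff] at hm
      rw [coeff_zero, mul_eq_zero] at h1
      exact h1.elim hm (Nat.cast_add_one_ne_zero _)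
    rw [totalDegree_eq_zero_iff_eq_C.1 hc] at h ⊢
    simpa [algebraMap_eq] using h

/-- The volume polynomial. -/
noncomputable def volPoly (K : Type) [Field K] {n : ℕ} (d : ℕ) (σ : Finset (Fin n)) :
    MvPolynomial (Fin n × Fin d) K :=
  if h : σ.card = d + 1 then
    Matrix.det
      ((Matrix.of (Fin.cons (fun _ => 1) fun i j => X (σ.orderEmbOfFin h j, i)) :
        Matrix (Fin (d + 1)) (Fin (d + 1)) (MvPolynomial (Fin n × Fin d) K)))
  else 0

lemma eval_volPoly (K : Type) [Field K] {n : ℕ} (d : ℕ) (σ : Finset (Fin n))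
    (p : Fin n → Fin d → K) : eval (fun j => p j.1 j.2) (volPoly K d σ) = vol K d σ p := by
  unfold volPoly vol
  split_ifs with h
  · rw [RingHom.map_det]
    congr 1
    ext i j
    refine Fin.cases ?_ (fun i => ?_) i <;> simp
  · simp

lemma map_volPoly {K K' : Type} [Field K] [Field K'] (φ : K →+* K') {n : ℕ} (d : ℕ)
    (σ : Finset (Fin n)) : map φ (volPoly K d σ) = volPoly K' d σ := by
  unfold volPoly
  split_ifs with h
  · rw [RingHom.map_det]
    congr 1
    ext1 i j
    refine Fin.cases ?_ (fun i => ?_) i <;> simp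
  · simp

/-- The coordinates on configuration space. -/
noncomputable def coordCLM (n d : ℕ) (j : Fin n × Fin d) : (Fin n → Fin d → ℝ) →L[ℝ] ℝ :=
  (ContinuousLinearMap.proj j.2).comp
    (ContinuousLinearMap.proj (R := ℝ) (φ := fun _ : Fin n => Fin d → ℝ) j.1)

lemma fderiv_vol {n d : ℕ} (σ : Finset (Fin n)) (p : Fin n → Fin d → ℝ) :
    fderiv ℝ (vol ℝ d σ) p =
      ∑ j, eval (fun j => p j.1 j.2) (pderiv j (volPoly ℝ d σ)) • coordCLM n d j := by
  have := hasFDerivAt_eval (coordCLM n d) (volPoly ℝ d σ) p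
  have h2 : (fun q : Fin n → Fin d → ℝ => eval (fun j => coordCLM n d j q) (volPoly ℝ d σ)) =
      vol ℝ d σ := funext fun q => eval_volPoly ℝ d σ q
  rw [h2] at this
  exact this.fderiv

lemma linIndep_iff {n d : ℕ} (H : Finset (Finset (Fin n))) (p : Fin n → Fin d → ℝ) :
    (LinearIndependent ℝ fun σ : H => fderiv ℝ (vol ℝ d σ.1) p) ↔
      ∀ v : H → ℝ, (∀ j, ∑ s, v s * eval (fun j => p j.1 j.2) (pderiv j (volPoly ℝ d s.1)) = 0) →
        v = 0 := by
  rw [Fintype.linearIndependent_iff]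
  have key : ∀ v : H → ℝ, (∑ s, v s • fderiv ℝ (vol ℝ d s.1) p = 0) ↔
      (∀ j, ∑ s, v s * eval (fun j => p j.1 j.2) (pderiv j (volPoly ℝ d s.1)) = 0) := by
    intro v
    have h1 : ∑ s, v s • fderiv ℝ (vol ℝ d s.1) p =
        ∑ j, (∑ s, v s * eval (fun j => p j.1 j.2) (pderiv j (volPoly ℝ d s.1))) •
          coordCLM n d j := by
      simp only [fderiv_vol, Finset.smul_sum, Finset.sum_smul, smul_smul]
      exact Finset.sum_comm
    rw [h1]
    constructor
    · intro h j
      have h2 := congrArg (fun T => T (Pi.single j.1 (Pi.single j.2 1))) h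
      simp only [sum_apply, smul_apply] at h2
      rw [Finset.sum_eq_single j] at h2
      · simpa [coordCLM] using h2
      · intro i _ hij
        have : coordCLM n d i (Pi.single j.1 (Pi.single j.2 1)) = 0 := by
          simp only [coordCLM, ContinuousLinearMap.comp_apply, ContinuousLinearMap.proj_apply]
          by_cases h1 : i.1 = j.1
          · have h2 : i.2 ≠ j.2 := fun h2 => hij (Prod.ext h1 h2)
            rw [h1, Pi.single_eq_same, Pi.single_eq_of_ne h2]
          · rw [Pi.single_eq_of_ne h1]; rfl
        rw [this, smul_zero]
      · simp
    · intro h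
      exact Finset.sum_eq_zero fun j _ => by rw [h j, zero_smul]
  simp only [key, funext_iff, Pi.zero_apply]

/-- The `d`-volume rigidity matroid is the algebraic matroid of the complex measurement
variety: a family `H` of `(d+1)`-subsets of `{1,…,n}` is independent in `R_n^d` (the
gradients of the volume maps are linearly independent at some real configuration) iff the
image of the complex measurement map `α_H` is Zariski dense in `ℂ^H`, i.e. the only
polynomial vanishing identically on the image of `α_H` is the zero polynomial. -/
theorem rigidity_matroid_is_algebraic_matroid (d n : ℕ) (hd : 1 ≤ d) (hn : d + 1 ≤ n)
    (H : Finset (Finset (Fin n))) (hH : ∀ σ ∈ H, σ.card = d + 1) :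
    (∃ p : Fin n → Fin d → ℝ,
        LinearIndependent ℝ fun σ : H => fderiv ℝ (vol ℝ d σ.1) p)
      ↔ ∀ g : MvPolynomial ↥H ℂ,
          (∀ p : Fin n → Fin d → ℂ,
            MvPolynomial.eval (fun σ : ↥H => vol ℂ d σ.1 p) g = 0) → g = 0 := by
  classical
  have heval : ∀ (g : MvPolynomial H ℂ) (x : Fin n × Fin d → ℂ),
      eval x (aeval (fun σ : H => volPoly ℂ d σ.1) g) =
        eval (fun σ : H => vol ℂ d σ.1 (fun i j => x (i, j))) g := by
    intro g x
    have : (fun σ : H => vol ℂ d σ.1 (fun i j => x (i, j))) =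
        fun σ : H => eval x (volPoly ℂ d σ.1) :=
      funext fun σ => (eval_volPoly ℂ d σ.1 (fun i j => x (i, j))).symm
    rw [this]
    induction g using MvPolynomial.induction_on with
    | C a => simp [algebraMap_eq]
    | add p q hp hq => simp only [map_add, hp, hq]
    | mul_X p i hp => simp only [map_mul, hp, aeval_X, eval_X]
  constructor
  · rintro ⟨p, hp⟩ g hg
    rw [linIndep_iff] at hp
    refine eq_zero_of_jacobian (fun σ : H => volPoly ℂ d σ.1) ?_ _ g le_rfl ?_
    · intro v hv
      let J : Matrix H (Fin n × Fin d) ℝ := Matrix.of fun s j =>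
        eval (fun j => p j.1 j.2) (pderiv j (volPoly ℝ d s.1))
      have hker : LinearMap.ker J.vecMulLinear = ⊥ := by
        rw [LinearMap.ker_eq_bot']
        intro w hw
        apply hp
        intro j
        exact congrFun hw j
      obtain ⟨r, hr⟩ := J.vecMulLinear.exists_leftInverse_of_injective hker
      let B : Matrix (Fin n × Fin d) H ℝ := (LinearMap.toMatrix' r)ᵀ
      have hJB : J * B = 1 := by
        ext s t
        have h := congrFun (LinearMap.congr_fun hr (Pi.single s 1)) t
        have h3 : (Matrix.vecMul (Pi.single s 1) (J * B)) t = (Pi.single s 1 : H → ℝ) t := by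
          rw [← Matrix.vecMul_vecMul]
          simp only [B, Matrix.vecMul_transpose]
          rw [← Matrix.toLin'_apply, Matrix.toLin'_toMatrix']
          exact h
        rw [Matrix.single_one_vecMul] at h3
        rw [Matrix.one_eq_pi_single]
        exact h3
      let JC : Matrix H (Fin n × Fin d) (MvPolynomial (Fin n × Fin d) ℂ) :=
        Matrix.of fun s j => pderiv j (volPoly ℂ d s.1)
      let BC : Matrix (Fin n × Fin d) H (MvPolynomial (Fin n × Fin d) ℂ) :=
        B.map fun x => C (x : ℂ)
      have hdet : (JC * BC).det ≠ 0 := by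
        intro h0
        have h1 := congrArg (eval fun j : Fin n × Fin d => (p j.1 j.2 : ℂ)) h0
        rw [RingHom.map_det, map_zero] at h1
        have h2 : (eval fun j : Fin n × Fin d => (p j.1 j.2 : ℂ)).mapMatrix (JC * BC) =
            (Complex.ofRealHom).mapMatrix (J * B) := by
          ext s t
          simp only [RingHom.mapMatrix_apply, Matrix.map_apply, Matrix.mul_apply, map_sum, map_mul]
          refine Finset.sum_congr rfl fun j _ => ?_
          congr 1
          · simp only [JC, J, Matrix.of_apply]
            rw [← map_volPoly Complex.ofRealHom, pderiv_map, eval_map]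
            exact (eval₂_comp_left Complex.ofRealHom (RingHom.id ℝ) _ _).symm
          · simp [BC]
        rw [h2, hJB, map_one, Matrix.det_one] at h1
        exact one_ne_zero h1
      apply Matrix.eq_zero_of_vecMul_eq_zero hdet
      rw [← Matrix.vecMul_vecMul]
      have : Matrix.vecMul v JC = 0 := funext fun j => hv j
      rw [this, Matrix.zero_vecMul]
    · apply MvPolynomial.funext
      intro x
      rw [heval, hg, map_zero]
  · intro h
    have hF : Function.Injective (aeval (fun σ : H => volPoly ℝ d σ.1) :
        MvPolynomial H ℝ →ₐ[ℝ] MvPolynomial (Fin n × Fin d) ℝ) := by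
      rw [injective_iff_map_eq_zero]
      intro g hg
      apply map_injective Complex.ofRealHom Complex.ofReal_injective
      rw [map_zero]
      apply h
      intro p
      rw [← heval _ (fun j => p j.1 j.2)]
      have : aeval (fun σ : H => volPoly ℂ d σ.1) (map Complex.ofRealHom g) =
          map Complex.ofRealHom (aeval (fun σ : H => volPoly ℝ d σ.1) g) := by
        clear hg
        induction g using MvPolynomial.induction_on with
        | C a => simp [algebraMap_eq]
        | add p q hp hq => simp only [map_add, hp, hq]
        | mul_X p i hp => simp only [map_mul, hp, aeval_X, map_X, map_volPoly]
      rw [this, hg, map_zero, map_zero]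
    obtain ⟨q, B, hq, hB⟩ := exists_right_inv _ hF
    obtain ⟨x, hx⟩ : ∃ x, eval x q ≠ 0 := by
      by_contra! hcon
      exact hq (MvPolynomial.funext fun x => by rw [hcon x, map_zero])
    refine ⟨fun i j => x (i, j), ?_⟩
    rw [linIndep_iff]
    intro v hv
    funext t
    have h1 : ∑ j, (∑ s, v s * eval x (pderiv j (volPoly ℝ d s.1))) * eval x (B j t) = 0 :=
      Finset.sum_eq_zero fun j _ => by
        have := hv j
        simp only [Prod.mk.eta] at this
        rw [this, zero_mul]
    simp only [Finset.sum_mul] at h1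
    rw [Finset.sum_comm] at h1
    have h2 : ∀ s, ∑ j, v s * eval x (pderiv j (volPoly ℝ d s.1)) * eval x (B j t) =
        if s = t then v s * eval x q else 0 := by
      intro s
      have := congrArg (eval x) (hB s t)
      simp only [map_sum, map_mul] at this
      simp only [mul_assoc, ← Finset.mul_sum]
      rw [this]
      split_ifs <;> simp
    simp only [h2, Finset.sum_ite_eq', Finset.mem_univ, if_true] at h1
    exact (mul_eq_zero.1 h1).resolve_right hx
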